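/- Let ĝ be a lift of a frice homeomorphism g of T². Then for every ẑ ∈ ℝ² and every ẑ' in the stable set K^s(ẑ), one has d(ĝ^j(ẑ'), ĝ^j(ẑ)) → 0 as j → +∞. -/

import Mathlib

open Metric Filter Topology MeasureTheory Set ENNReal

noncomputable section

abbrev R2 : Type := ℝ × ℝ

abbrev Torus : Type := AddCircle (1 : ℝ) × AddCircle (1 : ℝ)

instance : Fact ((0:ℝ) < 1) := ⟨one_pos⟩

/-- The covering projection `ℝ² → T²`. -/
def proj : R2 → Torus := fun p => ((p.1 : AddCircle (1:ℝ)), (p.2 : AddCircle (1:ℝ)))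

/-- `F : ℝ² → ℝ²` is a lift of `f : T² → T²` (commutes with the projection and
with the integer translations). -/
def IsLiftFun (f : Torus → Torus) (F : R2 → R2) : Prop :=
  (∀ x : R2, proj (F x) = f (proj x)) ∧
  ∀ (x : R2) (v : ℤ × ℤ), F (x + ((v.1 : ℝ), (v.2 : ℝ))) = F x + ((v.1 : ℝ), (v.2 : ℝ))

/-- Iteration of a homeomorphism indexed by `ℤ`. -/
def iterZ {X : Type*} [TopologicalSpace X] (F : X ≃ₜ X) : ℤ → X → X
  | Int.ofNat n => (⇑F)^[n]
  | Int.negSucc n => (⇑F.symm)^[n+1]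

/-- The rotation set of a lift. -/
def rotSet (F : R2 ≃ₜ R2) : Set R2 :=
  {v | ∃ (z : ℕ → R2) (n : ℕ → ℕ), Tendsto n atTop atTop ∧
    Tendsto (fun k => ((n k : ℝ))⁻¹ • ((⇑F)^[n k] (z k) - z k)) atTop (nhds v)}

/-- A continuum: a nonempty compact connected set. -/
def IsContinuum {X : Type*} [TopologicalSpace X] (K : Set X) : Prop :=
  IsCompact K ∧ IsConnected K

/-- Dynamical diameter of a set under a homeomorphism of the plane. -/
def dynDiam (F : R2 ≃ₜ R2) (K : Set R2) : ℝ≥0∞ :=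
  ⨆ j : ℤ, EMetric.diam (iterZ F j '' K)

/-- Topological mixing. -/
def TopologicallyMixing {X : Type*} [TopologicalSpace X] (h : X → X) : Prop :=
  ∀ U V : Set X, IsOpen U → IsOpen V → U.Nonempty → V.Nonempty →
    ∃ n₀ : ℕ, ∀ n, n₀ ≤ n → ((h^[n]) '' U ∩ V).Nonempty

/-- Maximal cardinality of a `(±n, ε)`-separated subset of `K`. -/
def sepCount (g : Torus ≃ₜ Torus) (n : ℕ) (ε : ℝ) (K : Set Torus) : ℕ :=
  sSup {m : ℕ | ∃ Y : Finset Torus, ↑Y ⊆ K ∧ Y.card = m ∧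
    ∀ y ∈ Y, ∀ y' ∈ Y, y ≠ y' →
      ∃ i : ℤ, |i| ≤ (n : ℤ) ∧ ε < dist (iterZ g i y) (iterZ g i y')}

/-- The two-sided entropy `h_±(g, K)` carried by `K`. -/
def entropyPM (g : Torus ≃ₜ Torus) (K : Set Torus) : EReal :=
  ⨆ (ε : ℝ) (_ : 0 < ε),
    limsup (fun n : ℕ => ((Real.log (sepCount g n ε K) / n : ℝ) : EReal)) atTop

/-- Connected component of the `ε`-stable set of `z` containing `z`. -/
def stableComp (G : R2 ≃ₜ R2) (ε : ℝ) (z : R2) : Set R2 :=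
  connectedComponentIn {z' : R2 | ∀ j : ℕ, dist ((⇑G)^[j] z') ((⇑G)^[j] z) ≤ ε} z

/-- The stable set of `z`. -/
def stableSet (G : R2 ≃ₜ R2) (z : R2) : Set R2 := ⋃ ε > 0, stableComp G ε z

/-- Connected component of the `ε`-unstable set of `z` containing `z`. -/
def unstableComp (G : R2 ≃ₜ R2) (ε : ℝ) (z : R2) : Set R2 :=
  connectedComponentIn {z' : R2 | ∀ j : ℕ, dist ((⇑G.symm)^[j] z') ((⇑G.symm)^[j] z) ≤ ε} z

/-- The unstable set of `z`. -/
def unstableSet (G : R2 ≃ₜ R2) (z : R2) : Set R2 := ⋃ ε > 0, unstableComp G ε z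

/-- Two points are dynamically related if some dynamically bounded continuum contains both. -/
def dynRel (F : R2 ≃ₜ R2) (z z' : R2) : Prop :=
  ∃ K : Set R2, IsContinuum K ∧ z ∈ K ∧ z' ∈ K ∧ dynDiam F K ≠ ⊤

/-- The equivalence class of `z` under the dynamically-bounded relation. -/
def dynClass (F : R2 ≃ₜ R2) (z : R2) : Set R2 := {z' | dynRel F z z'}


/-- The limit of a family of sets along an ultrafilter. -/
def ulim (U : Ultrafilter ℕ) (K : ℕ → Set R2) : Set R2 :=
  {x | ∀ V : Set R2, IsOpen V → x ∈ V → ∀ᶠ k in (U : Filter ℕ), (K k ∩ V).Nonempty}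

theorem ulim_mem (U : Ultrafilter ℕ) (K : ℕ → Set R2) (s : ℕ → R2)
    (hs : ∀ᶠ k in (U : Filter ℕ), s k ∈ K k) (x : R2)
    (hx : Tendsto s U (nhds x)) : x ∈ ulim U K := by
  intro V hV hxV
  filter_upwards [hs, hx.eventually (hV.mem_nhds hxV)] with k h1 h2
  exact ⟨s k, h1, h2⟩

theorem exists_ultra_lim (U : Ultrafilter ℕ) (B : Set R2) (hB : IsCompact B) (s : ℕ → R2)
    (hs : ∀ᶠ k in (U : Filter ℕ), s k ∈ B) : ∃ x ∈ B, Tendsto s U (nhds x) := by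
  have h := hB.ultrafilter_le_nhds (U.map s) (le_principal_iff.2 hs)
  obtain ⟨x, hx, h⟩ := h
  exact ⟨x, hx, h⟩

theorem ulim_closed (U : Ultrafilter ℕ) (K : ℕ → Set R2) : IsClosed (ulim U K) := by
  rw [← isOpen_compl_iff, isOpen_iff_mem_nhds]
  intro x hx
  have hx' : ¬ ∀ V : Set R2, IsOpen V → x ∈ V →
    ∀ᶠ k in (U : Filter ℕ), (K k ∩ V).Nonempty := hx
  push Not at hx'
  obtain ⟨V, hV, hxV, hn⟩ := hx'
  refine mem_of_superset (hV.mem_nhds hxV) ?_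
  intro y hy hyL
  obtain ⟨k, h1, h2⟩ := ((show ∀ᶠ k in (U : Filter ℕ), K k ∩ V = ∅ from hn).and (hyL V hV hy)).exists
  simp_all

theorem ulim_subset (U : Ultrafilter ℕ) (K : ℕ → Set R2) (B : Set R2) (hB : IsClosed B)
    (h : ∀ k, K k ⊆ B) : ulim U K ⊆ B := by
  intro x hx
  by_contra hxB
  obtain ⟨k, y, hy, hyB⟩ := (hx Bᶜ hB.isOpen_compl hxB).exists
  exact hyB (h k hy)

theorem ulim_preconn (U : Ultrafilter ℕ) (K : ℕ → Set R2) (B : Set R2) (hB : IsCompact B)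
    (h : ∀ k, K k ⊆ B) (hc : ∀ k, IsPreconnected (K k)) : IsPreconnected (ulim U K) := by
  rw [isPreconnected_iff_subset_of_fully_disjoint_closed (ulim_closed U K)]
  intro A C hA hC hAC hdisj
  by_contra hcon
  push Not at hcon
  obtain ⟨h1, h2⟩ := hcon
  obtain ⟨x, hx, hxA⟩ := not_subset.1 h1
  obtain ⟨y, hy, hyC⟩ := not_subset.1 h2
  have hxC : x ∈ C := (hAC hx).resolve_left hxA
  have hyA : y ∈ A := (hAC hy).resolve_right hyC
  obtain ⟨V, W, hV, hW, hAV, hCW, hVW⟩ := normal_separation hA hC hdisj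
  have key : ∀ᶠ k in (U : Filter ℕ), ∃ p ∈ K k, p ∉ V ∪ W := by
    filter_upwards [hx W hW (hCW hxC), hy V hV (hAV hyA)] with k hkW hkV
    by_contra hno
    push Not at hno
    obtain ⟨p, -, hp1, hp2⟩ := hc k V W hV hW hno hkV hkW
    exact disjoint_left.1 hVW hp1 hp2
  classical
  let s : ℕ → R2 := fun k => if hk : ∃ p ∈ K k, p ∉ V ∪ W then hk.choose else 0
  have hs : ∀ᶠ k in (U : Filter ℕ), s k ∈ K k ∧ s k ∉ V ∪ W := by
    filter_upwards [key] with k hk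
    simp only [s, dif_pos hk]
    exact hk.choose_spec
  obtain ⟨p, -, hp⟩ := exists_ultra_lim U B hB s (hs.mono fun k hk => h k hk.1)
  have hpL := ulim_mem U K s (hs.mono fun k hk => hk.1) p hp
  have hpn : p ∈ (V ∪ W)ᶜ :=
    (hV.union hW).isClosed_compl.mem_of_tendsto hp (hs.mono fun k hk => hk.2)
  exact hpn ((hAC hpL).imp (fun q => hAV q) (fun q => hCW q))

theorem iter_comm (F : R2 → R2) (v : R2) (h : ∀ x, F (x + v) = F x + v) (n : ℕ) (x : R2) :
    F^[n] (x + v) = F^[n] x + v := by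
  induction n generalizing x with
  | zero => rfl
  | succ n ih => simp only [Function.iterate_succ_apply, h, ih]

theorem iterZ_comm (G : R2 ≃ₜ R2) (v : R2) (h : ∀ x, G (x + v) = G x + v) (j : ℤ) (x : R2) :
    iterZ G j (x + v) = iterZ G j x + v := by
  cases j with
  | ofNat n => exact iter_comm G v h n x
  | negSucc n =>
    refine iter_comm G.symm v (fun y => ?_) (n+1) x
    rw [G.symm_apply_eq, h, G.apply_symm_apply]

theorem iterZ_cont (G : R2 ≃ₜ R2) (j : ℤ) : Continuous (iterZ G j) := by
  cases j with
  | ofNat n => exact G.continuous.iterate n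
  | negSucc n => exact G.symm.continuous.iterate (n+1)

theorem iterZ_iter (G : R2 ≃ₜ R2) (j : ℤ) :
    ∃ N : ℕ, ∀ n, N ≤ n → ∃ m : ℕ, ∀ x, iterZ G j (G^[n] x) = G^[m] x := by
  cases j with
  | ofNat k =>
    refine ⟨0, fun n _ => ⟨k + n, fun x => ?_⟩⟩
    exact (Function.iterate_add_apply G k n x).symm
  | negSucc k =>
    refine ⟨k+1, fun n hn => ⟨n - (k+1), fun x => ?_⟩⟩
    obtain ⟨d, rfl⟩ := Nat.exists_eq_add_of_le hn
    rw [Function.iterate_add_apply, Nat.add_sub_cancel_left]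
    exact (Function.LeftInverse.iterate G.symm_apply_apply (k+1)) _

/-- Points of the stable set of `z` are forward asymptotic to `z`. -/
theorem stable_set_dist_tendsto_zero
    (g : Torus ≃ₜ Torus) (G : R2 ≃ₜ R2) (hG : IsLiftFun ⇑g ⇑G)
    (hrot : (interior (rotSet G)).Nonempty)
    (hexp : ∀ K : Set R2, IsContinuum K → K.Nontrivial → dynDiam G K = ⊤)
    (z z' : R2) (hz' : z' ∈ stableSet G z) :
    Tendsto (fun j : ℕ => dist ((⇑G)^[j] z') ((⇑G)^[j] z)) atTop (nhds 0) := by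
  by_contra hcon
  simp only [stableSet, mem_iUnion] at hz'
  obtain ⟨ε, hε, hz'⟩ := hz'
  set S : Set R2 := {z' : R2 | ∀ j : ℕ, dist ((⇑G)^[j] z') ((⇑G)^[j] z) ≤ ε} with hS
  have hzS : z ∈ S := by
    intro j
    rw [dist_self]
    exact le_of_lt hε
  set C : Set R2 := connectedComponentIn S z with hC
  have hz'C : z' ∈ C := hz'
  have hzC : z ∈ C := mem_connectedComponentIn hzS
  have hCS : C ⊆ S := connectedComponentIn_subset S z
  have hCc : IsPreconnected C := isPreconnected_connectedComponentIn
  -- frequently far apart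
  have hfreq : ∃ δ > 0, ∃ᶠ j : ℕ in atTop, δ ≤ dist ((⇑G)^[j] z') ((⇑G)^[j] z) := by
    by_contra hno
    push Not at hno
    apply hcon
    rw [Metric.tendsto_nhds]
    intro δ hδ
    filter_upwards [hno δ hδ] with j hj
    rw [Real.dist_0_eq_abs, abs_of_nonneg dist_nonneg]
    exact hj
  obtain ⟨δ, hδ, hfreq⟩ := hfreq
  rw [frequently_iff_neBot] at hfreq
  let U : Ultrafilter ℕ := @Ultrafilter.of _ _ hfreq
  have hU : (U : Filter ℕ) ≤ _ := @Ultrafilter.of_le _ _ hfreq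
  have hUtop : (U : Filter ℕ) ≤ atTop := hU.trans inf_le_left
  have hUδ : ∀ᶠ j in (U : Filter ℕ), δ ≤ dist ((⇑G)^[j] z') ((⇑G)^[j] z) :=
    (hU.trans inf_le_right) (mem_principal_self _)
  let v : ℕ → R2 := fun n =>
    (((-⌊(G^[n] z).1⌋ : ℤ) : ℝ), ((-⌊(G^[n] z).2⌋ : ℤ) : ℝ))
  have hv : ∀ n x, G (x + v n) = G x + v n := fun n x =>
    hG.2 x (-⌊(G^[n] z).1⌋, -⌊(G^[n] z).2⌋)
  let T : ℕ → R2 → R2 := fun n x => G^[n] x + v n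
  have hTc : ∀ n, Continuous (T n) := fun n => (G.continuous.iterate n).add continuous_const
  have hTz : ∀ n, dist (T n z) 0 ≤ 1 := by
    intro n
    have h1 := Int.floor_le (G^[n] z).1
    have h2 := Int.lt_floor_add_one (G^[n] z).1
    have h3 := Int.floor_le (G^[n] z).2
    have h4 := Int.lt_floor_add_one (G^[n] z).2
    rw [Prod.dist_eq]
    simp only [T, v, Prod.fst_add, Prod.snd_add, Real.dist_eq, Prod.fst_zero, Prod.snd_zero,
      Int.cast_neg]
    apply max_le <;> rw [abs_le] <;> constructor <;> linarith
  let K : ℕ → Set R2 := fun n => T n '' C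
  have hKB : ∀ n, K n ⊆ closedBall 0 (ε + 1) := by
    rintro n _ ⟨x, hx, rfl⟩
    have h1 : dist (T n x) (T n z) ≤ ε := by
      simp only [T, dist_add_right]
      exact hCS hx n
    exact (dist_triangle _ (T n z) _).trans (add_le_add h1 (hTz n))
  have hB : IsCompact (closedBall (0 : R2) (ε + 1)) := isCompact_closedBall _ _
  have hKc : ∀ n, IsPreconnected (K n) := fun n => hCc.image _ (hTc n).continuousOn
  obtain ⟨a, -, ha⟩ := exists_ultra_lim U _ hB (fun n => T n z)
    (Eventually.of_forall fun n => hKB n ⟨z, hzC, rfl⟩)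
  obtain ⟨b, -, hb⟩ := exists_ultra_lim U _ hB (fun n => T n z')
    (Eventually.of_forall fun n => hKB n ⟨z', hz'C, rfl⟩)
  have haL : a ∈ ulim U K := ulim_mem U K _ (Eventually.of_forall fun n => ⟨z, hzC, rfl⟩) a ha
  have hbL : b ∈ ulim U K := ulim_mem U K _ (Eventually.of_forall fun n => ⟨z', hz'C, rfl⟩) b hb
  have hab : δ ≤ dist b a := by
    refine ge_of_tendsto (hb.dist ha) ?_
    filter_upwards [hUδ] with n hn
    simpa only [T, dist_add_right] using hn
  have hne : b ≠ a := by
    rintro rfl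
    rw [dist_self] at hab
    exact absurd hδ (not_lt.2 hab)
  have hLc : IsContinuum (ulim U K) :=
    ⟨hB.of_isClosed_subset (ulim_closed U K) (ulim_subset U K _ isClosed_closedBall hKB),
      ⟨a, haL⟩, ulim_preconn U K _ hB hKB hKc⟩
  have htop := hexp _ hLc ⟨b, hbL, a, haL, hne⟩
  have hbound : dynDiam G (ulim U K) ≤ ENNReal.ofReal (ε + ε) := by
    refine iSup_le fun j => ?_
    refine Metric.ediam_le ?_
    rintro _ ⟨x, hx, rfl⟩ _ ⟨y, hy, rfl⟩
    rw [edist_dist]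
    refine ENNReal.ofReal_le_ofReal ?_
    by_contra hlt
    push Not at hlt
    have hopen : IsOpen {p : R2 × R2 | ε + ε < dist (iterZ G j p.1) (iterZ G j p.2)} :=
      isOpen_lt continuous_const
        (((iterZ_cont G j).comp continuous_fst).dist ((iterZ_cont G j).comp continuous_snd))
    obtain ⟨V, W, hV, hW, hxV, hyW, hVW⟩ := isOpen_prod_iff.1 hopen x y hlt
    obtain ⟨N, hN⟩ := iterZ_iter G j
    obtain ⟨n, ⟨_, ⟨p, hp, rfl⟩, hpV⟩, ⟨_, ⟨q, hq, rfl⟩, hqW⟩, hn⟩ :=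
      ((hx V hV hxV).and ((hy W hW hyW).and (hUtop (eventually_ge_atTop N)))).exists
    have hlt2 : ε + ε < dist (iterZ G j (T n p)) (iterZ G j (T n q)) := 
      hVW (show (T n p, T n q) ∈ V ×ˢ W from ⟨hpV, hqW⟩)
    obtain ⟨m, hm⟩ := hN n hn
    simp only [T, iterZ_comm G (v n) (hv n), dist_add_right, hm] at hlt2
    have h1 := hCS hp m
    have h2 := hCS hq m
    have h3 := dist_triangle_right (G^[m] p) (G^[m] q) (G^[m] z)
    linarith
  rw [htop] at hbound
  exact ENNReal.ofReal_ne_top (top_le_iff.1 hbound)
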